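/- The coefficients b(n) defined by ∑_{n≥0} b(n)q^n = q(1+q)·∑_{n≥0} (−q^{2n+3};q²)_∞ q^{2n}/(q^{2n+2};q)_∞ are weakly increasing: b(n+1) ≥ b(n) for all n ≥ 0. Equivalently, (1−q) times this series has nonnegative power series coefficients. -/

import Mathlib

open scoped BigOperators

namespace Stmt19
open Filter Topology

/-- `f` is given on `(0,1)` by a power series with nonnegative coefficients. -/
def IsPos (f : ℝ → ℝ) : Prop :=
  ∃ a : ℕ → ℝ, (∀ n, 0 ≤ a n) ∧ ∀ q : ℝ, 0 < q → q < 1 → HasSum (fun n => a n * q ^ n) (f q)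

lemma IsPos.nonneg {f : ℝ → ℝ} (hf : IsPos f) {q : ℝ} (h0 : 0 < q) (h1 : q < 1) : 0 ≤ f q := by
  obtain ⟨a, ha, h⟩ := hf
  exact (h q h0 h1).nonneg fun n => mul_nonneg (ha n) (by positivity)

lemma IsPos.congr {f g : ℝ → ℝ} (hf : IsPos f) (h : ∀ q, 0 < q → q < 1 → f q = g q) : IsPos g := by
  obtain ⟨a, ha, h'⟩ := hf
  exact ⟨a, ha, fun q h0 h1 => h q h0 h1 ▸ h' q h0 h1⟩

lemma isPos_pow (k : ℕ) : IsPos fun q => q ^ k := by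
  refine ⟨fun n => if n = k then 1 else 0, fun n => by dsimp only; split_ifs <;> norm_num, fun q _ _ => ?_⟩
  have := hasSum_ite_eq k (q ^ k)
  refine this.congr_fun ?_ |> id
  intro n
  by_cases h : n = k <;> simp [h]

lemma isPos_one : IsPos fun _ => 1 := by simpa using isPos_pow 0

lemma IsPos.add {f g : ℝ → ℝ} (hf : IsPos f) (hg : IsPos g) : IsPos fun q => f q + g q := by
  obtain ⟨a, ha, h⟩ := hf
  obtain ⟨b, hb, h'⟩ := hg
  refine ⟨fun n => a n + b n, fun n => add_nonneg (ha n) (hb n), fun q h0 h1 => ?_⟩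
  simpa [add_mul] using (h q h0 h1).add (h' q h0 h1)

lemma IsPos.mul {f g : ℝ → ℝ} (hf : IsPos f) (hg : IsPos g) : IsPos fun q => f q * g q := by
  obtain ⟨a, ha, h⟩ := hf
  obtain ⟨b, hb, h'⟩ := hg
  refine ⟨fun n => ∑ kl ∈ Finset.HasAntidiagonal.antidiagonal n, a kl.1 * b kl.2,
    fun n => Finset.sum_nonneg fun i _ => mul_nonneg (ha _) (hb _), fun q h0 h1 => ?_⟩
  have s1 := (h q h0 h1).summable.norm
  have s2 := (h' q h0 h1).summable.norm
  have s3 := (summable_norm_sum_mul_antidiagonal_of_summable_norm s1 s2).of_norm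
  have e := tsum_mul_tsum_eq_tsum_sum_antidiagonal_of_summable_norm s1 s2
  rw [(h q h0 h1).tsum_eq, (h' q h0 h1).tsum_eq] at e
  have s4 := s3.hasSum
  rw [← e] at s4
  suffices e5 : (fun n => (∑ kl ∈ Finset.HasAntidiagonal.antidiagonal n, a kl.1 * b kl.2) * q ^ n) =
      fun n => ∑ kl ∈ Finset.HasAntidiagonal.antidiagonal n,
        a kl.1 * q ^ kl.1 * (b kl.2 * q ^ kl.2) by
    rw [e5]
    exact s4
  funext n
  rw [Finset.sum_mul]
  refine Finset.sum_congr rfl fun kl hkl => ?_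
  rw [← Finset.HasAntidiagonal.mem_antidiagonal.1 hkl, pow_add]
  ring

lemma isPos_hasSum {F : ℕ → ℝ → ℝ} {f : ℝ → ℝ} (hF : ∀ k, IsPos (F k))
    (h : ∀ q, 0 < q → q < 1 → HasSum (fun k => F k q) (f q)) : IsPos f := by
  choose a ha hs using hF
  have key : ∀ q, 0 < q → q < 1 → Summable (fun p : ℕ × ℕ => a p.1 p.2 * q ^ p.2) := by
    intro q h0 h1
    refine (summable_prod_of_nonneg fun p => mul_nonneg (ha _ _) (by positivity)).2
      ⟨fun k => (hs k q h0 h1).summable, ?_⟩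
    simpa [fun k => (hs k q h0 h1).tsum_eq] using (h q h0 h1).summable
  refine ⟨fun n => ∑' k, a k n, fun n => tsum_nonneg fun k => ha k n, fun q h0 h1 => ?_⟩
  have h2 := (key q h0 h1).hasSum
  have h3 := h2.prod_fiberwise (fun k => hs k q h0 h1)
  have h4 := h3.unique (h q h0 h1)
  rw [h4] at h2
  have h5 := (Equiv.prodComm ℕ ℕ).hasSum_iff.2 h2
  have h6 := h5.prod_fiberwise (fun n => (h5.summable.prod_factor n).hasSum)
  convert h6 using 2 with n
  exact tsum_mul_right.symm

lemma isPos_tendsto {F : ℕ → ℝ → ℝ} {f : ℝ → ℝ} (h0 : IsPos (F 0))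
    (hF : ∀ k, IsPos (fun q => F (k+1) q - F k q))
    (h : ∀ q, 0 < q → q < 1 → Tendsto (fun k => F k q) atTop (𝓝 (f q))) : IsPos f := by
  have : IsPos (fun q => f q - F 0 q) := by
    refine isPos_hasSum hF fun q h0 h1 => ?_
    rw [hasSum_iff_tendsto_nat_of_nonneg fun k => (hF k).nonneg h0 h1]
    simp_rw [Finset.sum_range_sub (fun k => F k q)]
    exact (h q h0 h1).sub_const _
  exact (h0.add this).congr fun q _ _ => by ring

lemma isPos_prod_tendsto {u : ℕ → ℝ → ℝ} {f : ℝ → ℝ}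
    (hu : ∀ k, IsPos (fun q => u k q - 1))
    (h : ∀ q, 0 < q → q < 1 →
      Tendsto (fun k => ∏ i ∈ Finset.range k, u i q) atTop (𝓝 (f q))) : IsPos f := by
  have hp : ∀ k, IsPos (fun q => ∏ i ∈ Finset.range k, u i q) := by
    intro k
    induction k with
    | zero => simpa using isPos_one
    | succ k ih =>
      refine (ih.mul ((hu k).add isPos_one)).congr fun q _ _ => ?_
      rw [Finset.prod_range_succ]; ring
  refine isPos_tendsto (hp 0) (fun k => ?_) h
  refine ((hp k).mul (hu k)).congr fun q _ _ => ?_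
  rw [Finset.prod_range_succ]; ring

lemma isPos_geom (k : ℕ) (hk : 0 < k) : IsPos fun q => (1 - q ^ k)⁻¹ := by
  refine isPos_hasSum (F := fun j q => q ^ (k * j)) (fun j => isPos_pow _) fun q h0 h1 => ?_
  simp_rw [pow_mul]
  exact hasSum_geometric_of_lt_one (by positivity) (pow_lt_one₀ h0.le h1 hk.ne')

lemma isPos_geom_sub (k : ℕ) (hk : 0 < k) : IsPos fun q => (1 - q ^ k)⁻¹ - 1 := by
  refine ((isPos_pow k).mul (isPos_geom k hk)).congr fun q h0 h1 => ?_
  have : q ^ k < 1 := pow_lt_one₀ h0.le h1 hk.ne'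
  have : 1 - q ^ k ≠ 0 := by linarith
  field_simp
  ring

noncomputable def P (m : ℕ) (q : ℝ) : ℝ := ∏' j : ℕ, (1 + q ^ m * (q ^ 2) ^ j)
noncomputable def D (m : ℕ) (q : ℝ) : ℝ := ∏' j : ℕ, (1 - q ^ m * q ^ j)

lemma sumP (m : ℕ) {q : ℝ} (h0 : 0 < q) (h1 : q < 1) :
    Summable fun j : ℕ => ‖q ^ m * (q ^ 2) ^ j‖ :=
  ((summable_geometric_of_lt_one (by positivity) (pow_lt_one₀ h0.le h1 two_ne_zero)).mul_left _).norm

lemma sumD (m : ℕ) {q : ℝ} (h0 : 0 < q) (h1 : q < 1) :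
    Summable fun j : ℕ => ‖-(q ^ m * q ^ j)‖ :=
  ((summable_geometric_of_lt_one h0.le h1).mul_left _).neg.norm

lemma mulP (m : ℕ) {q : ℝ} (h0 : 0 < q) (h1 : q < 1) :
    Multipliable fun j : ℕ => 1 + q ^ m * (q ^ 2) ^ j :=
  multipliable_one_add_of_summable (sumP m h0 h1)

lemma mulD (m : ℕ) {q : ℝ} (h0 : 0 < q) (h1 : q < 1) :
    Multipliable fun j : ℕ => 1 - q ^ m * q ^ j := by
  simpa [sub_eq_add_neg] using multipliable_one_add_of_summable (sumD m h0 h1)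

lemma facD (m j : ℕ) (hm : 0 < m) {q : ℝ} (h0 : 0 < q) (h1 : q < 1) :
    0 < 1 - q ^ m * q ^ j := by
  have : q ^ (m + j) < 1 := pow_lt_one₀ h0.le h1 (by omega)
  rw [pow_add] at this
  linarith

lemma D_ne (m : ℕ) (hm : 0 < m) {q : ℝ} (h0 : 0 < q) (h1 : q < 1) : D m q ≠ 0 := by
  have := tprod_one_add_ne_zero_of_summable (f := fun j => -(q ^ m * q ^ j))
    (fun j => by have := facD m j hm h0 h1; simpa [sub_eq_add_neg] using this.ne') (sumD m h0 h1)
  simpa [D, sub_eq_add_neg] using this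

lemma P_ne (m : ℕ) {q : ℝ} (h0 : 0 < q) (h1 : q < 1) : P m q ≠ 0 := by
  exact tprod_one_add_ne_zero_of_summable (f := fun j => (q ^ m * (q^2) ^ j))
    (fun j => by positivity) (sumP m h0 h1)

lemma P_step (m : ℕ) {q : ℝ} (h0 : 0 < q) (h1 : q < 1) : P m q = (1 + q ^ m) * P (m + 2) q := by
  have e : ∀ j : ℕ, 1 + q ^ m * (q ^ 2) ^ (j + 1) = 1 + q ^ (m + 2) * (q ^ 2) ^ j := by
    intro j; ring
  unfold P
  rw [tprod_eq_zero_mul' (by simpa only [e] using mulP (m + 2) h0 h1)]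
  simp only [e]
  simp

lemma D_step (m : ℕ) {q : ℝ} (h0 : 0 < q) (h1 : q < 1) : D m q = (1 - q ^ m) * D (m + 1) q := by
  have e : ∀ j : ℕ, 1 - q ^ m * q ^ (j + 1) = 1 - q ^ (m + 1) * q ^ j := by
    intro j; ring
  unfold D
  rw [tprod_eq_zero_mul' (by simpa only [e] using mulD (m + 1) h0 h1)]
  simp only [e]
  simp

lemma P_tendsto (m : ℕ) {q : ℝ} (h0 : 0 < q) (h1 : q < 1) :
    Tendsto (fun k => P (m + 2 * k) q) atTop (𝓝 1) := by
  have e : ∀ k, P m q = (∏ j ∈ Finset.range k, (1 + q ^ m * (q ^ 2) ^ j)) * P (m + 2 * k) q := by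
    intro k
    induction k with
    | zero => simp
    | succ k ih =>
      rw [ih, Finset.prod_range_succ, P_step (m + 2 * k) h0 h1]
      ring_nf
  have t := (mulP m h0 h1).tendsto_prod_tprod_nat
  have t2 := (tendsto_const_nhds (x := P m q)).div t (P_ne m h0 h1)
  change Tendsto _ _ (𝓝 (P m q / P m q)) at t2
  rw [div_self (P_ne m h0 h1)] at t2
  refine t2.congr fun k => ?_
  have : (∏ j ∈ Finset.range k, (1 + q ^ m * (q ^ 2) ^ j)) ≠ 0 :=
    Finset.prod_ne_zero_iff.2 fun j _ => by positivity
  simp only [Pi.div_apply]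
  rw [div_eq_iff this, e k, mul_comm]

lemma D_tendsto (m : ℕ) (hm : 0 < m) {q : ℝ} (h0 : 0 < q) (h1 : q < 1) :
    Tendsto (fun k => D (m + k) q) atTop (𝓝 1) := by
  have e : ∀ k, D m q = (∏ j ∈ Finset.range k, (1 - q ^ m * q ^ j)) * D (m + k) q := by
    intro k
    induction k with
    | zero => simp
    | succ k ih =>
      rw [ih, Finset.prod_range_succ, D_step (m + k) h0 h1]
      ring_nf
  have t := (mulD m h0 h1).tendsto_prod_tprod_nat
  have t2 := (tendsto_const_nhds (x := D m q)).div t (D_ne m hm h0 h1)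
  change Tendsto _ _ (𝓝 (D m q / D m q)) at t2
  rw [div_self (D_ne m hm h0 h1)] at t2
  refine t2.congr fun k => ?_
  have : (∏ j ∈ Finset.range k, (1 - q ^ m * q ^ j)) ≠ 0 :=
    Finset.prod_ne_zero_iff.2 fun j _ => (facD m j hm h0 h1).ne'
  simp only [Pi.div_apply]
  rw [div_eq_iff this, e k, mul_comm]

lemma P_pos (m : ℕ) : IsPos (P m) := by
  refine isPos_prod_tendsto (u := fun j q => 1 + q ^ m * (q ^ 2) ^ j) (fun k => ?_)
    fun q h0 h1 => (mulP m h0 h1).tendsto_prod_tprod_nat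
  exact (isPos_pow (m + 2 * k)).congr fun q _ _ => by ring

lemma D_pos (m : ℕ) (hm : 0 < m) : IsPos (fun q => (D m q)⁻¹) := by
  refine isPos_prod_tendsto (u := fun j q => (1 - q ^ (m + j))⁻¹)
    (fun k => isPos_geom_sub _ (by omega)) fun q h0 h1 => ?_
  have := ((mulD m h0 h1).tendsto_prod_tprod_nat).inv₀ (D_ne m hm h0 h1)
  refine this.congr fun k => ?_
  simp [pow_add]

noncomputable def A (n : ℕ) (q : ℝ) : ℝ := P (2 * n + 3) q / D (2 * n + 2) q

lemma A_pos (n : ℕ) : IsPos (A n) :=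
  ((P_pos (2 * n + 3)).mul (D_pos (2 * n + 2) (by omega))).congr fun q _ _ => by
    simp [A, div_eq_mul_inv]

lemma A_tendsto {q : ℝ} (h0 : 0 < q) (h1 : q < 1) : Tendsto (fun n => A n q) atTop (𝓝 1) := by
  have t1 := P_tendsto 3 h0 h1
  have t2 := (D_tendsto 2 (by norm_num) h0 h1).comp
    (tendsto_id.const_mul_atTop' (show 0 < 2 by norm_num))
  have := t1.div t2 one_ne_zero
  rw [div_one] at this
  refine this.congr fun n => ?_
  simp [A, add_comm]

noncomputable def C (n : ℕ) (q : ℝ) : ℝ :=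
  A (n + 1) q * (q ^ (2 * n + 2) + (q ^ (2 * n + 3) + q ^ (2 * n + 3)) * (1 - q ^ (2 * n + 3))⁻¹)

lemma C_pos (n : ℕ) : IsPos (C n) :=
  (A_pos (n + 1)).mul ((isPos_pow _).add
    (((isPos_pow _).add (isPos_pow _)).mul (isPos_geom _ (by omega))))

lemma A_step (n : ℕ) {q : ℝ} (h0 : 0 < q) (h1 : q < 1) :
    (1 - q ^ (2 * n + 2)) * A n q =
      A (n + 1) q * ((1 + q ^ (2 * n + 3)) * (1 - q ^ (2 * n + 3))⁻¹) := by
  unfold A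
  rw [P_step (2 * n + 3) h0 h1, D_step (2 * n + 2) h0 h1, D_step (2 * n + 2 + 1) h0 h1]
  have a1 : 1 - q ^ (2 * n + 2) ≠ 0 := by
    have : q ^ (2 * n + 2) < 1 := pow_lt_one₀ h0.le h1 (by omega)
    linarith
  have a2 : 1 - q ^ (2 * n + 2 + 1) ≠ 0 := by
    have : q ^ (2 * n + 2 + 1) < 1 := pow_lt_one₀ h0.le h1 (by omega)
    linarith
  have a3 := D_ne (2 * n + 2 + 1 + 1) (by omega) h0 h1
  rw [show 2 * (n + 1) + 3 = 2 * n + 3 + 2 by ring, show 2 * (n + 1) + 2 = 2 * n + 2 + 1 + 1 by ring,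
    show 2 * n + 3 = 2 * n + 2 + 1 by ring]
  generalize D (2 * n + 2 + 1 + 1) q = d at *
  generalize P (2 * n + 2 + 1 + 2) q = p at *
  generalize q ^ (2 * n + 2 + 1) = x at *
  generalize q ^ (2 * n + 2) = y at *
  field_simp

lemma partial_sum (N : ℕ) {q : ℝ} (h0 : 0 < q) (h1 : q < 1) :
    ∑ n ∈ Finset.range (N + 1), (1 - q ^ 2) * (A n q * q ^ (2 * n)) =
      (1 - q ^ (2 * N + 2)) * A N q + ∑ n ∈ Finset.range N, C n q := by
  induction N with
  | zero => simp
  | succ N ih =>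
    rw [Finset.sum_range_succ, ih, Finset.sum_range_succ _ N, A_step N h0 h1, C]
    have a2 : 1 - q ^ (2 * N + 3) ≠ 0 := by
      have : q ^ (2 * N + 3) < 1 := pow_lt_one₀ h0.le h1 (by omega)
      linarith
    have e1 : q ^ (2 * (N + 1)) = q ^ (2 * N + 2) := by ring
    have e2 : q ^ (2 * (N + 1) + 2) = q ^ (2 * N + 2) * q ^ 2 := by ring
    rw [e1, e2]
    generalize q ^ (2 * N + 3) = x at *
    generalize q ^ (2 * N + 2) = y at *
    field_simp
    ring

lemma summable_A {q : ℝ} (h0 : 0 < q) (h1 : q < 1) : Summable fun n => A n q * q ^ (2 * n) := by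
  obtain ⟨M, hM⟩ := (A_tendsto h0 h1).bddAbove_range
  have hg : Summable fun n : ℕ => M * q ^ (2 * n) := by
    simp_rw [pow_mul]
    exact (summable_geometric_of_lt_one (by positivity)
      (pow_lt_one₀ h0.le h1 two_ne_zero)).mul_left _
  refine Summable.of_nonneg_of_le (fun n => mul_nonneg ((A_pos n).nonneg h0 h1) (by positivity))
    (fun n => ?_) hg
  exact mul_le_mul_of_nonneg_right (hM ⟨n, rfl⟩) (by positivity)

lemma hasSum_C {q : ℝ} (h0 : 0 < q) (h1 : q < 1) :
    HasSum (fun n => C n q) ((1 - q ^ 2) * (∑' n, A n q * q ^ (2 * n)) - 1) := by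
  rw [hasSum_iff_tendsto_nat_of_nonneg fun k => (C_pos k).nonneg h0 h1]
  have t1 := (((summable_A h0 h1).hasSum.mul_left (1 - q ^ 2)).tendsto_sum_nat).comp
    (tendsto_add_atTop_nat 1)
  have t3 : Tendsto (fun N : ℕ => q ^ (2 * N + 2)) atTop (𝓝 0) :=
    (tendsto_pow_atTop_nhds_zero_of_lt_one h0.le h1).comp
      (tendsto_atTop_mono (fun N => by simp only [id]; omega) tendsto_id)
  have t2 := (t3.const_sub 1).mul (A_tendsto h0 h1)
  have := t1.sub t2
  simp only [sub_zero, mul_one] at this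
  refine this.congr fun N => ?_
  simp only [Function.comp_apply]
  rw [partial_sum N h0 h1]
  ring

lemma eq_zero_of_hasSum (d : ℕ → ℝ)
    (h : ∀ q, 0 < q → q < 1 → HasSum (fun n => d n * q ^ n) 0) : ∀ n, d n = 0 := by
  set p : FormalMultilinearSeries ℝ ℝ ℝ := FormalMultilinearSeries.ofScalars ℝ d with hp
  have hs : HasFPowerSeriesAt (fun z => ∑' n, d n * z ^ n) p 0 := by
    rw [hasFPowerSeriesAt_iff]
    have : ∀ᶠ z : ℝ in 𝓝 0, |z| < 1 := by
      have := Metric.ball_mem_nhds (0 : ℝ) one_pos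
      filter_upwards [this] with z hz
      simpa using hz
    filter_upwards [this] with z hz
    have : Summable (fun n => d n * z ^ n) := by
      rcases eq_or_ne z 0 with rfl | hz0
      · exact summable_of_ne_finset_zero (s := {0}) fun n hn => by simp at hn; simp [hn]
      · have := (h |z| (abs_pos.2 hz0) hz).summable.norm
        refine Summable.of_norm ?_
        simpa using this
    simpa [hp, mul_comm] using this.hasSum
  have hp0 : p = 0 := by
    by_contra hne
    have h1 := hs.locally_ne_zero hne
    have h2 : ∀ᶠ z : ℝ in 𝓝[>] 0, (∑' n, d n * z ^ n) ≠ 0 :=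
      h1.filter_mono (nhdsWithin_mono _ fun z hz => ne_of_gt hz)
    have h3 : ∀ᶠ z : ℝ in 𝓝[>] 0, z ∈ Set.Ioo (0 : ℝ) 1 := Ioo_mem_nhdsGT one_pos
    obtain ⟨z, hz, hz'⟩ := (h2.and h3).exists
    exact hz (h z hz'.1 hz'.2).tsum_eq
  intro n
  have : p.coeff n = d n := by simp [hp]
  rw [← this, hp0]
  rfl

end Stmt19

/-- The coefficients `b(n)` of
`∑_{n≥0} b(n) q^n = q(1+q) ∑_{n≥0} (-q^{2n+3};q²)_∞ q^{2n}/(q^{2n+2};q)_∞`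
are weakly increasing. -/
theorem stmt_19 (b : ℕ → ℝ)
    (hb : ∀ q : ℝ, |q| < 1 →
      ∑' n : ℕ, b n * q ^ n
        = q * (1 + q) * ∑' n : ℕ,
            (∏' j : ℕ, (1 + q ^ (2 * n + 3) * (q ^ 2) ^ j)) * q ^ (2 * n) /
              ∏' j : ℕ, (1 - q ^ (2 * n + 2) * q ^ j)) :
    ∀ n : ℕ, b n ≤ b (n + 1) := by
  open Stmt19 in
  have hG : IsPos (fun q => (1 - q ^ 2) * (∑' n, A n q * q ^ (2 * n))) := by
    have : IsPos (fun q => (1 - q ^ 2) * (∑' n, A n q * q ^ (2 * n)) - 1) :=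
      isPos_hasSum C_pos fun q h0 h1 => hasSum_C h0 h1
    exact (this.add isPos_one).congr fun q _ _ => by ring
  obtain ⟨g, hg, hgs⟩ := hG
  have hb' : ∀ q : ℝ, 0 < q → q < 1 →
      HasSum (fun n => b n * q ^ n) (q * (1 + q) * ∑' n, Stmt19.A n q * q ^ (2 * n)) := by
    intro q h0 h1
    have e := hb q (by rwa [abs_of_pos h0])
    have e2 : ∀ n : ℕ, (∏' j : ℕ, (1 + q ^ (2 * n + 3) * (q ^ 2) ^ j)) * q ^ (2 * n) /
              ∏' j : ℕ, (1 - q ^ (2 * n + 2) * q ^ j) = Stmt19.A n q * q ^ (2 * n) := by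
      intro n
      simp only [Stmt19.A, Stmt19.P, Stmt19.D]
      ring
    simp only [e2] at e
    rw [← e]
    apply Summable.hasSum
    by_contra hns
    rw [tsum_eq_zero_of_not_summable hns] at e
    have hC := (Stmt19.hasSum_C h0 h1).nonneg fun k => (Stmt19.C_pos k).nonneg h0 h1
    rcases mul_eq_zero.1 e.symm with h | h
    · have : 0 < q * (1 + q) := by positivity
      linarith
    · rw [h] at hC
      norm_num at hC
  -- the difference sequence
  let d : ℕ → ℝ := fun n => match n with
    | 0 => b 0
    | n + 1 => b (n + 1) - b n - g n
  have hd : ∀ n, d n = 0 := by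
    apply Stmt19.eq_zero_of_hasSum
    intro q h0 h1
    have s := hb' q h0 h1
    have sg := (hgs q h0 h1).mul_left q
    have s1 := (hasSum_nat_add_iff' 1).2 s
    have s2 := (s1.sub (s.mul_left q)).sub sg
    rw [← hasSum_nat_add_iff' 1]
    convert s2 using 1
    · funext n
      simp only [d]
      ring
    · simp [d]
      ring
  intro n
  have h1 := hd (n + 1)
  have h2 := hg n
  simp only [d] at h1
  linarith
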